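/- Let V(ν₁,ν₂,r) be the 4×4 squeezed-thermal covariance matrix in standard form with symplectic eigenvalues ν₁, ν₂ ≥ 1/2 and squeezing strength r > 0, and let D(V) = JBV + VBJ − JAJ be the linear dissipator for damping with global vacuum (single Lindblad operator L = a₁ + a₂), where B = ½[[J₂,J₂],[J₂,J₂]] and A = ½[[I₂,I₂],[I₂,I₂]] in 2×2 block form. Then there exists a real symmetric 4×4 matrix G with JGV − VGJ + D(V) = 0 if and only if ν₁ = ν₂ = cosh(2r)/2. -/

import Mathlib

open Matrix

noncomputable def J4 : Matrix (Fin 4) (Fin 4) ℝ :=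
  !![0, 1, 0, 0; -1, 0, 0, 0; 0, 0, 0, 1; 0, 0, -1, 0]

noncomputable def Vsf (ν₁ ν₂ r : ℝ) : Matrix (Fin 4) (Fin 4) ℝ :=
  !![ν₁ * Real.cosh r ^ 2 + ν₂ * Real.sinh r ^ 2, 0,
       (ν₁ + ν₂) / 2 * Real.sinh (2*r), 0;
     0, ν₁ * Real.cosh r ^ 2 + ν₂ * Real.sinh r ^ 2, 0,
       -((ν₁ + ν₂) / 2 * Real.sinh (2*r));
     (ν₁ + ν₂) / 2 * Real.sinh (2*r), 0,
       ν₁ * Real.sinh r ^ 2 + ν₂ * Real.cosh r ^ 2, 0;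
     0, -((ν₁ + ν₂) / 2 * Real.sinh (2*r)), 0,
       ν₁ * Real.sinh r ^ 2 + ν₂ * Real.cosh r ^ 2]

noncomputable def Bgv : Matrix (Fin 4) (Fin 4) ℝ :=
  (1/2 : ℝ) • !![0, 1, 0, 1; -1, 0, -1, 0; 0, 1, 0, 1; -1, 0, -1, 0]

noncomputable def Agv : Matrix (Fin 4) (Fin 4) ℝ :=
  (1/2 : ℝ) • !![1, 0, 1, 0; 0, 1, 0, 1; 1, 0, 1, 0; 0, 1, 0, 1]

/-- A standard-form covariance matrix with opposite correlations, stabilizable under damping with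
global vacuum, satisfies the two trace conditions obtained by pairing the stabilizability equation
with `V⁻¹` and with `J V J`. -/
theorem trace_conditions_of_stabilizable {a b c : ℝ} {V G : Matrix (Fin 4) (Fin 4) ℝ}
    (hV : V = !![a, 0, c, 0; 0, a, 0, -c; c, 0, b, 0; 0, -c, 0, b]) (hG : Gᵀ = G)
    (h : J4 * G * V - V * G * J4 + (J4 * Bgv * V + V * Bgv * J4 - J4 * Agv * J4) = 0) :
    4 * (a * b - c ^ 2) = a + b ∧ 2 * (a ^ 2 + b ^ 2) - 4 * c ^ 2 = a + b := by
  subst hV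
  have symm (i j : Fin 4) : G j i = G i j := congrFun (congrFun hG i) j
  have entry (i j : Fin 4) := congrFun (congrFun h i) j
  have h00 := entry 0 0
  have h02 := entry 0 2
  have h11 := entry 1 1
  have h13 := entry 1 3
  have h22 := entry 2 2
  have h33 := entry 3 3
  simp only [Matrix.add_apply, Matrix.sub_apply, Matrix.mul_apply, Fin.sum_univ_four]
    at h00 h02 h11 h13 h22 h33
  simp [J4, Agv, Bgv,
    symm 0 1, symm 0 3, symm 1 2, symm 2 3] at h00 h02 h11 h13 h22 h33
  constructor
  · linear_combination -b * h00 - a * h22 + 2 * c * h02 - b * h11 - a * h33 - 2 * c * h13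
  · linear_combination -a * h00 - b * h22 + 2 * c * h02 - a * h11 - b * h33 - 2 * c * h13

theorem stmt_16 (ν₁ ν₂ r : ℝ) (h1 : 1/2 ≤ ν₁) (h2 : 1/2 ≤ ν₂) (hr : 0 < r) :
    (∃ G : Matrix (Fin 4) (Fin 4) ℝ, Gᵀ = G ∧
        J4 * G * Vsf ν₁ ν₂ r - Vsf ν₁ ν₂ r * G * J4
          + (J4 * Bgv * Vsf ν₁ ν₂ r + Vsf ν₁ ν₂ r * Bgv * J4 - J4 * Agv * J4) = 0) ↔
    (ν₁ = Real.cosh (2*r) / 2 ∧ ν₂ = Real.cosh (2*r) / 2) := by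
  constructor
  · rintro ⟨G, hG, h⟩
    obtain ⟨hdet, hser⟩ := trace_conditions_of_stabilizable rfl hG h
    have hcs := Real.cosh_sq r
    have hdiff : ν₁ * Real.cosh r ^ 2 + ν₂ * Real.sinh r ^ 2 -
        (ν₁ * Real.sinh r ^ 2 + ν₂ * Real.cosh r ^ 2) = 0 := by
      refine pow_eq_zero_iff two_ne_zero |>.mp ?_
      linear_combination (hser - hdet) / 2
    have hν : ν₂ = ν₁ := by
      linear_combination -hdiff + (ν₁ - ν₂) * hcs
    subst hν
    rw [Real.sinh_two_mul] at hdet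
    have hne : ν₂ ≠ 0 := by linarith
    have key : ν₂ = Real.cosh (2 * r) / 2 := by
      refine mul_left_cancel₀ hne ?_
      rw [Real.cosh_two_mul]
      rw [hcs] at hdet ⊢
      linear_combination hdet / 4 + 4 * ν₂ ^ 2 * Real.sinh r ^ 2 * hcs
    exact ⟨key, key⟩
  · rintro ⟨rfl, rfl⟩
    have hC : Real.cosh (2 * r) ≠ 0 := (Real.cosh_pos _).ne'
    have hsum : Real.cosh r ^ 2 + Real.sinh r ^ 2 = Real.cosh (2 * r) := (Real.cosh_two_mul r).symm
    have hsq := Real.cosh_sq (2 * r)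
    have ha : Real.cosh (2 * r) / 2 * Real.cosh r ^ 2 + Real.cosh (2 * r) / 2 * Real.sinh r ^ 2 =
        Real.cosh (2 * r) ^ 2 / 2 := by
      linear_combination Real.cosh (2 * r) / 2 * hsum
    have hb : Real.cosh (2 * r) / 2 * Real.sinh r ^ 2 + Real.cosh (2 * r) / 2 * Real.cosh r ^ 2 =
        Real.cosh (2 * r) ^ 2 / 2 := by
      linear_combination Real.cosh (2 * r) / 2 * hsum
    have ht : Real.sinh (2 * r) / (2 * Real.cosh (2 * r)) * Real.cosh (2 * r) =
        Real.sinh (2 * r) / 2 := by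
      field_simp
    generalize Real.sinh (2 * r) / (2 * Real.cosh (2 * r)) = t at ht
    refine ⟨!![0, t, 0, t; t, 0, t, 0; 0, t, 0, t; t, 0, t, 0], ?_, ?_⟩
    · ext i j
      fin_cases i <;> fin_cases j <;> rfl
    · rw [Vsf, ha, hb]
      generalize Real.cosh (2 * r) = C at *
      generalize Real.sinh (2 * r) = S at *
      ext i j
      simp only [Matrix.add_apply, Matrix.sub_apply, Matrix.mul_apply, Fin.sum_univ_four]
      fin_cases i <;> fin_cases j <;> simp [J4, Agv, Bgv]
      all_goals first
        | linear_combination (C + S) * ht - hsq / 2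
        | linear_combination -(C - S) * ht - hsq / 2
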